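/- Let ε > 0, C > 0, let f : ℝ → [0,∞) be Lebesgue measurable with ‖f‖_{L¹(ℝ)} < ∞ and ‖f‖_{L^{1+ε}(ℝ)} < ∞, let (c_n)_{n≥1} be a bounded sequence of nonnegative reals, and let (κ_n)_{n≥1} be reals with κ_n ≥ C·n for all n ≥ 1. For κ > 0 define the kernel K_κ(x,x') := (f(x) f(x'))^{1/2} · ∑_{n=1}^∞ (c_n / (2 √(κ_n² + κ²))) e^{−√(κ_n² + κ²) |x−x'|}. Then ∫_{ℝ²} K_κ(x,x')² dx dx' → 0 as κ → +∞. -/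

import Mathlib

open MeasureTheory

/-- The exponential decays faster than a small negative power. -/
lemma exp_neg_le_rpow_neg {x δ : ℝ} (hx : 0 < x) (hδ : 0 ≤ δ) (hδ1 : δ ≤ 1) :
    Real.exp (-x) ≤ x ^ (-δ) := by
  rw [Real.exp_neg, Real.rpow_neg hx.le]
  have hpos : 0 < x ^ δ := Real.rpow_pos_of_pos hx δ
  refine inv_anti₀ hpos ?_
  have h : x ^ δ ≤ (x + 1) ^ δ := Real.rpow_le_rpow hx.le (by linarith) hδ
  have h' : (x + 1) ^ δ ≤ (x + 1) ^ (1 : ℝ) :=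
    Real.rpow_le_rpow_of_exponent_le (by linarith) hδ1
  rw [Real.rpow_one] at h'
  linarith [Real.add_one_le_exp x]

/-- Pointwise bound on one term of the kernel series. -/
lemma kernel_term_le {a M s t r d δ : ℝ} (haM : a ≤ M) (hM : 0 ≤ M) (ht : 0 < t)
    (hr : 0 < r) (hts : t ≤ s) (hrs : r ≤ s) (hd : 0 < d) (hδ : 0 < δ) (hδ1 : δ ≤ 1) :
    a / (2 * s) * Real.exp (-s * d) ≤ M * d ^ (-δ) * t ^ (-(δ / 2)) * r ^ (-(1 + δ / 2)) := by
  have hs : 0 < s := ht.trans_le hts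
  have hexp : Real.exp (-s * d) ≤ s ^ (-δ) * d ^ (-δ) := by
    rw [← Real.mul_rpow hs.le hd.le, neg_mul]
    exact exp_neg_le_rpow_neg (mul_pos hs hd) hδ.le hδ1
  have hcoef : a / (2 * s) ≤ M * s ^ (-1 : ℝ) := by
    rw [Real.rpow_neg_one, ← div_eq_mul_inv]
    gcongr
    linarith
  have ht' : s ^ (-(δ / 2)) ≤ t ^ (-(δ / 2)) :=
    Real.rpow_le_rpow_of_nonpos ht hts (by linarith)
  have hr' : s ^ (-(1 + δ / 2)) ≤ r ^ (-(1 + δ / 2)) :=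
    Real.rpow_le_rpow_of_nonpos hr hrs (by linarith)
  have hsplit : s ^ (-1 : ℝ) * s ^ (-δ) = s ^ (-(δ / 2)) * s ^ (-(1 + δ / 2)) := by
    rw [← Real.rpow_add hs, ← Real.rpow_add hs]
    congr 1
    ring
  calc a / (2 * s) * Real.exp (-s * d)
      ≤ M * s ^ (-1 : ℝ) * (s ^ (-δ) * d ^ (-δ)) := by gcongr
    _ = M * d ^ (-δ) * (s ^ (-1 : ℝ) * s ^ (-δ)) := by ring
    _ = M * d ^ (-δ) * (s ^ (-(δ / 2)) * s ^ (-(1 + δ / 2))) := by rw [hsplit]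
    _ ≤ M * d ^ (-δ) * (t ^ (-(δ / 2)) * r ^ (-(1 + δ / 2))) := by gcongr
    _ = _ := by ring

/-- The function `u ↦ u ^ (-1/2)` restricted to `(0, 1]`. -/
noncomputable def truncInvSqrt : ℝ → ℝ :=
  (Set.Ioc (0 : ℝ) 1).indicator fun u => u ^ (-(1 / 2) : ℝ)

lemma truncInvSqrt_nonneg (u : ℝ) : 0 ≤ truncInvSqrt u :=
  Set.indicator_nonneg (fun _ hu => Real.rpow_nonneg hu.1.le _) u

lemma integrable_truncInvSqrt : Integrable truncInvSqrt := by
  have h : IntervalIntegrable (fun u : ℝ => u ^ (-(1 / 2) : ℝ)) volume 0 1 :=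
    intervalIntegral.intervalIntegrable_rpow' (by norm_num)
  rw [intervalIntegrable_iff_integrableOn_Ioc_of_le zero_le_one] at h
  exact h.integrable_indicator measurableSet_Ioc

/-- Young's inequality for a weakly singular weight, cut off at distance one. -/
lemma mul_abs_rpow_le {ε y u : ℝ} (hε : 0 < ε) (hy : 0 ≤ y) (hu : u ≠ 0) :
    y * |u| ^ (-(2 * (ε / (4 * (1 + ε))))) ≤
      y + y ^ (1 + ε) + (truncInvSqrt u + truncInvSqrt (-u)) := by
  have hu' : 0 < |u| := abs_pos.2 hu
  have h0 := truncInvSqrt_nonneg u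
  have h0' := truncInvSqrt_nonneg (-u)
  have hy' : 0 ≤ y ^ (1 + ε) := Real.rpow_nonneg hy _
  rcases le_or_gt |u| 1 with h | h
  · have hpq : (1 + ε).HolderConjugate ((1 + ε) / ε) := by
      rw [Real.holderConjugate_iff]
      refine ⟨by linarith, ?_⟩
      field_simp
    have hyoung := Real.young_inequality_of_nonneg hy
      (Real.rpow_nonneg hu'.le (-(2 * (ε / (4 * (1 + ε)))))) hpq
    rw [← Real.rpow_mul hu'.le] at hyoung
    have he : -(2 * (ε / (4 * (1 + ε)))) * ((1 + ε) / ε) = -(1 / 2) := by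
      field_simp
      norm_num
    rw [he] at hyoung
    have hpow : |u| ^ (-(1 / 2) : ℝ) ≤ truncInvSqrt u + truncInvSqrt (-u) := by
      rcases lt_or_gt_of_ne hu with hneg | hpos
      · rw [abs_of_neg hneg] at h hu' ⊢
        have : truncInvSqrt (-u) = (-u) ^ (-(1 / 2) : ℝ) :=
          Set.indicator_of_mem (Set.mem_Ioc.2 ⟨hu', h⟩) _
        linarith
      · rw [abs_of_pos hpos] at h hu' ⊢
        have : truncInvSqrt u = u ^ (-(1 / 2) : ℝ) :=
          Set.indicator_of_mem (Set.mem_Ioc.2 ⟨hu', h⟩) _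
        linarith
    have h3 : y ^ (1 + ε) / (1 + ε) ≤ y ^ (1 + ε) := div_le_self hy' (by linarith)
    have h4 : |u| ^ (-(1 / 2) : ℝ) / ((1 + ε) / ε) ≤ |u| ^ (-(1 / 2) : ℝ) :=
      div_le_self (Real.rpow_nonneg hu'.le _) hpq.symm.lt.le
    linarith
  · have : |u| ^ (-(2 * (ε / (4 * (1 + ε))))) ≤ 1 :=
      Real.rpow_le_one_of_one_le_of_nonpos h.le (neg_nonpos.2 (by positivity))
    nlinarith

lemma ae_fst_ne_snd : ∀ᵐ p : ℝ × ℝ, p.1 ≠ p.2 := by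
  have h : (volume : Measure (ℝ × ℝ)) (Set.diagonal ℝ) = 0 := by
    rw [Measure.volume_eq_prod, Measure.measure_prod_null measurableSet_diagonal]
    refine Filter.Eventually.of_forall fun x => ?_
    have : Prod.mk x ⁻¹' Set.diagonal ℝ = {x} := by
      ext y
      simp [eq_comm]
    simp [this]
  exact measure_eq_zero_iff_ae_notMem.1 h

/-- An integrable majorant of `(x, y) ↦ f x * f y * |x - y| ^ (-2δ)`. -/
lemma integrable_majorant {ε : ℝ} {f : ℝ → ℝ} (h1 : Integrable f)
    (h2 : Integrable fun x : ℝ => f x ^ (1 + ε)) :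
    Integrable fun p : ℝ × ℝ => f p.2 * (f p.1 + f p.1 ^ (1 + ε) +
      (truncInvSqrt (p.1 - p.2) + truncInvSqrt (-(p.1 - p.2)))) := by
  have hA : Integrable (fun p : ℝ × ℝ => (f p.1 + f p.1 ^ (1 + ε)) * f p.2) :=
    (h1.add h2).mul_prod h1
  have hg : Integrable (fun u => truncInvSqrt u + truncInvSqrt (-u)) :=
    integrable_truncInvSqrt.add integrable_truncInvSqrt.comp_neg
  have hB := h1.convolution_integrand (ContinuousLinearMap.mul ℝ ℝ) hg
  refine (hA.add hB).congr (Filter.Eventually.of_forall fun p => ?_)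
  simp only [Pi.add_apply, ContinuousLinearMap.mul_apply']
  ring

/-- Corollary 3.2(i)–(ii): the Hilbert–Schmidt norm of the Birman–Schwinger kernel
tends to 0 as κ → ∞. -/
theorem stmt_19 (ε C : ℝ) (hε : 0 < ε) (hC : 0 < C)
    (f : ℝ → ℝ) (hfm : Measurable f) (hf0 : ∀ x, 0 ≤ f x)
    (h1 : Integrable f) (h2 : Integrable (fun x : ℝ => f x ^ (1 + ε)))
    (c : ℕ → ℝ) (hc0 : ∀ n, 0 ≤ c n) (hcb : ∃ M : ℝ, ∀ n, c n ≤ M)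
    (κ : ℕ → ℝ) (hκ : ∀ n : ℕ, 1 ≤ n → C * n ≤ κ n) :
    Filter.Tendsto
      (fun t : ℝ => ∫ p : ℝ × ℝ,
        (Real.sqrt (f p.1 * f p.2) *
            ∑' n : ℕ, (c (n + 1) / (2 * Real.sqrt (κ (n + 1) ^ 2 + t ^ 2)))
              * Real.exp (-(Real.sqrt (κ (n + 1) ^ 2 + t ^ 2)) * |p.1 - p.2|)) ^ 2)
      Filter.atTop (nhds 0) := by
  obtain ⟨M, hM⟩ := hcb
  have hM0 : 0 ≤ M := (hc0 0).trans (hM 0)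
  obtain ⟨δ, hδdef⟩ : ∃ δ : ℝ, δ = ε / (4 * (1 + ε)) := ⟨_, rfl⟩
  have hδ : 0 < δ := by rw [hδdef]; positivity
  have hδ1 : δ ≤ 1 := by
    rw [hδdef, div_le_one (by positivity)]
    linarith
  have hsum : Summable fun n : ℕ => (C * ((n + 1 : ℕ) : ℝ)) ^ (-(1 + δ / 2)) := by
    have h : Summable fun n : ℕ => (n : ℝ) ^ (-(1 + δ / 2)) :=
      Real.summable_nat_rpow.2 (by linarith)
    refine (((summable_nat_add_iff 1).2 h).mul_left (C ^ (-(1 + δ / 2)))).congr fun n => ?_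
    rw [Real.mul_rpow hC.le (Nat.cast_nonneg _)]
  set S : ℝ := ∑' n : ℕ, (C * ((n + 1 : ℕ) : ℝ)) ^ (-(1 + δ / 2)) with hS
  set G : ℝ × ℝ → ℝ := fun p => f p.2 * (f p.1 + f p.1 ^ (1 + ε) +
    (truncInvSqrt (p.1 - p.2) + truncInvSqrt (-(p.1 - p.2)))) with hG
  have hGint : Integrable G := integrable_majorant h1 h2
  have hlim : Filter.Tendsto (fun t : ℝ => t ^ (-δ) * ((M * S) ^ 2 * ∫ p, G p))
      Filter.atTop (nhds 0) := by
    simpa using (tendsto_rpow_neg_atTop hδ).mul_const ((M * S) ^ 2 * ∫ p, G p)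
  refine squeeze_zero' (Filter.Eventually.of_forall fun t => integral_nonneg fun p => sq_nonneg _)
    ?_ hlim
  filter_upwards [Filter.eventually_gt_atTop 0] with t ht
  rw [← integral_const_mul, ← integral_const_mul]
  refine integral_mono_of_nonneg (Filter.Eventually.of_forall fun p => sq_nonneg _)
    ((hGint.const_mul _).const_mul _) ?_
  filter_upwards [ae_fst_ne_snd] with p hp
  have hd : 0 < |p.1 - p.2| := abs_pos.2 (sub_ne_zero.2 hp)
  set d : ℝ := |p.1 - p.2| with hddef
  have hterm : ∀ n : ℕ, (c (n + 1) / (2 * Real.sqrt (κ (n + 1) ^ 2 + t ^ 2)))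
      * Real.exp (-(Real.sqrt (κ (n + 1) ^ 2 + t ^ 2)) * d) ≤
      M * d ^ (-δ) * t ^ (-(δ / 2)) * (C * ((n + 1 : ℕ) : ℝ)) ^ (-(1 + δ / 2)) := by
    intro n
    refine kernel_term_le (hM _) hM0 ht (by positivity)
      (Real.le_sqrt_of_sq_le (by nlinarith [sq_nonneg (κ (n + 1))]))
      ((hκ (n + 1) (by omega)).trans (Real.le_sqrt_of_sq_le (by nlinarith [sq_nonneg t])))
      hd hδ hδ1
  have hnonneg : ∀ n : ℕ, 0 ≤ (c (n + 1) / (2 * Real.sqrt (κ (n + 1) ^ 2 + t ^ 2)))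
      * Real.exp (-(Real.sqrt (κ (n + 1) ^ 2 + t ^ 2)) * d) := fun n => by
    have := hc0 (n + 1)
    positivity
  have hmaj := hsum.mul_left (M * d ^ (-δ) * t ^ (-(δ / 2)))
  have htsum := (Summable.of_nonneg_of_le hnonneg hterm hmaj).tsum_le_tsum hterm hmaj
  rw [tsum_mul_left, ← hS] at htsum
  have hff : 0 ≤ f p.1 * f p.2 := mul_nonneg (hf0 _) (hf0 _)
  have hd2 : (d ^ (-δ)) ^ 2 = d ^ (-(2 * δ)) := by
    rw [← Real.rpow_mul_natCast hd.le]
    congr 1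
    push_cast
    ring
  have ht2 : (t ^ (-(δ / 2))) ^ 2 = t ^ (-δ) := by
    rw [← Real.rpow_mul_natCast ht.le]
    congr 1
    push_cast
    ring
  have hyoung := mul_abs_rpow_le hε (hf0 p.1) (sub_ne_zero.2 hp)
  rw [← hδdef, ← hddef] at hyoung
  rw [mul_pow, Real.sq_sqrt hff]
  calc _ ≤ f p.1 * f p.2 * (M * d ^ (-δ) * t ^ (-(δ / 2)) * S) ^ 2 :=
        mul_le_mul_of_nonneg_left (pow_le_pow_left₀ (tsum_nonneg hnonneg) htsum 2) hff
    _ = t ^ (-δ) * ((M * S) ^ 2 * (f p.2 * (f p.1 * d ^ (-(2 * δ))))) := by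
        rw [← hd2, ← ht2]
        ring
    _ ≤ t ^ (-δ) * ((M * S) ^ 2 * G p) := by
        have := hf0 p.2
        simp only [hG]
        gcongr
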